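/- arXiv:0803.0757 — 8 statements merged into one kernel-verified Lean document; each statement's English description precedes it below -/
import Mathlib

section
/- Let (M_k)_{k=1,…,d²} be a family of d² Hermitian d×d complex matrices that are Hilbert–Schmidt orthonormal, i.e. tr(M_i M_j) = δ_{i,j}. If two density matrices ρ and σ on ℂ^d have equal (non-symmetric) covariance matrices, γ(ρ,{M_k}) = γ(σ,{M_k}), then ρ = σ. -/
open Matrix BigOperators
open scoped ComplexOrder

noncomputable section

/-- Expectation value ⟨X⟩ = tr(ρ X). -/
def expVal {n : Type*} [Fintype n] (ρ X : Matrix n n ℂ) : ℂ := (ρ * X).trace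

/-- The (non-symmetric) covariance matrix of a family of observables. -/
def covMat {n ι : Type*} [Fintype n] [Fintype ι]
    (ρ : Matrix n n ℂ) (M : ι → Matrix n n ℂ) : Matrix ι ι ℂ :=
  Matrix.of fun i j => expVal ρ (M i * M j) - expVal ρ (M i) * expVal ρ (M j)

/-- A Hilbert–Schmidt orthonormal family of `d ^ 2` matrices spans the matrix space. -/
theorem span_eq_top_of_trace_orthonormal {d : ℕ}
    (M : Fin (d ^ 2) → Matrix (Fin d) (Fin d) ℂ)
    (hON : ∀ i j, (M i * M j).trace = if i = j then 1 else 0) :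
    Submodule.span ℂ (Set.range M) = ⊤ := by
  have hli : LinearIndependent ℂ M := by
    rw [Fintype.linearIndependent_iff]
    intro g hg i
    have h := congrArg (fun X => (X * M i).trace) hg
    simpa [Finset.sum_mul, Matrix.trace_sum, hON] using h
  apply hli.span_eq_top_of_card_eq_finrank'
  simp [Module.finrank_matrix, sq]

/-- A linear map vanishing on a spanning family vanishes. -/
theorem linearMap_eq_zero_of_span_eq_top {ι V W : Type*} [AddCommGroup V] [Module ℂ V]
    [AddCommGroup W] [Module ℂ W] {v : ι → V} (hv : Submodule.span ℂ (Set.range v) = ⊤)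
    (f : V →ₗ[ℂ] W) (hf : ∀ i, f (v i) = 0) (x : V) : f x = 0 :=
  LinearMap.congr_fun (LinearMap.ext_on_range (g := 0) hv (by simpa using hf)) x

/-- A traceless matrix commuting with every matrix is zero. -/
theorem eq_zero_of_commute_of_trace_eq_zero {d : ℕ} (D : Matrix (Fin d) (Fin d) ℂ)
    (hD : ∀ A, D * A = A * D) (htr : D.trace = 0) : D = 0 := by
  obtain ⟨c, rfl⟩ := Matrix.mem_range_scalar_of_commute_single
    (M := D) (fun i j _ => (hD (Matrix.single i j 1)).symm)
  rcases d with _ | d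
  · exact Subsingleton.elim _ _
  · have hc : c = 0 := by
      simpa [Matrix.trace, Nat.cast_add_one_ne_zero] using htr
    simp [hc]

/-- A tomographically complete Hilbert–Schmidt orthonormal family of Hermitian
matrices: the non-symmetric covariance matrix determines the state. -/
theorem covMat_determines_state {d : ℕ}
    (M : Fin (d ^ 2) → Matrix (Fin d) (Fin d) ℂ)
    (hHerm : ∀ k, (M k).IsHermitian)
    (hON : ∀ i j, (M i * M j).trace = if i = j then 1 else 0)
    (ρ σ : Matrix (Fin d) (Fin d) ℂ)
    (hρ : ρ.PosSemidef) (hρ1 : ρ.trace = 1)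
    (hσ : σ.PosSemidef) (hσ1 : σ.trace = 1)
    (hγ : covMat ρ M = covMat σ M) : ρ = σ := by
  have hspan := span_eq_top_of_trace_orthonormal M hON
  have hsymm : ∀ i j, ((ρ - σ) * (M i * M j)).trace = ((ρ - σ) * (M j * M i)).trace := by
    intro i j
    have h1 := congrFun (congrFun hγ i) j
    have h2 := congrFun (congrFun hγ j) i
    simp only [covMat, expVal, Matrix.of_apply] at h1 h2
    simp only [sub_mul, Matrix.trace_sub]
    linear_combination h1 - h2
  have hzero : ∀ X : Matrix (Fin d) (Fin d) ℂ, (∀ j, (X * M j).trace = 0) → X = 0 := by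
    intro X hX
    rw [Matrix.ext_iff_trace_mul_right]
    intro A
    simpa using linearMap_eq_zero_of_span_eq_top hspan
      (Matrix.traceLinearMap (Fin d) ℂ ℂ ∘ₗ LinearMap.mulLeft ℂ X) (by simpa using hX) A
  have hcomm : ∀ i, (ρ - σ) * M i - M i * (ρ - σ) = 0 := by
    intro i
    apply hzero
    intro j
    rw [sub_mul, Matrix.trace_sub, mul_assoc, hsymm, mul_assoc, Matrix.trace_mul_comm (M i),
      mul_assoc, sub_self]
  have hcomm' : ∀ A, (ρ - σ) * A = A * (ρ - σ) := by
    intro A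
    have h := linearMap_eq_zero_of_span_eq_top hspan
      (LinearMap.mulLeft ℂ (ρ - σ) - LinearMap.mulRight ℂ (ρ - σ)) (by simpa using hcomm) A
    exact sub_eq_zero.mp (by simpa using h)
  exact sub_eq_zero.mp (eq_zero_of_commute_of_trace_eq_zero _ hcomm'
    (by rw [Matrix.trace_sub, hρ1, hσ1, sub_self]))
end
end

section
/- There exist two distinct density matrices ρ ≠ σ on ℂ² whose symmetric covariance matrices with respect to the normalized Pauli basis M₁ = I/√2, M₂ = σ_x/√2, M₃ = σ_y/√2, M₄ = σ_z/√2 coincide: γ^S(ρ,{M_k}) = γ^S(σ,{M_k}). Hence the symmetric covariance matrix does not determine the state. -/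
open Matrix BigOperators
open scoped ComplexOrder

noncomputable section

/-- The symmetric covariance matrix of a family of observables. -/
def symCovMat {n ι : Type*} [Fintype n] [Fintype ι]
    (ρ : Matrix n n ℂ) (M : ι → Matrix n n ℂ) : Matrix ι ι ℂ :=
  Matrix.of fun i j =>
    (expVal ρ (M i * M j) + expVal ρ (M j * M i)) / 2 - expVal ρ (M i) * expVal ρ (M j)

/-- The normalized Pauli basis: I/√2, σ_x/√2, σ_y/√2, σ_z/√2. -/
def pauliBasis : Fin 4 → Matrix (Fin 2) (Fin 2) ℂ :=
  ![((Real.sqrt 2 : ℝ) : ℂ)⁻¹ • (1 : Matrix (Fin 2) (Fin 2) ℂ),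
    ((Real.sqrt 2 : ℝ) : ℂ)⁻¹ • !![0, 1; 1, 0],
    ((Real.sqrt 2 : ℝ) : ℂ)⁻¹ • !![0, -Complex.I; Complex.I, 0],
    ((Real.sqrt 2 : ℝ) : ℂ)⁻¹ • !![1, 0; 0, -1]]

/-- There exist two distinct one-qubit density matrices whose symmetric
covariance matrices with respect to the normalized Pauli basis coincide. -/
theorem symCovMat_does_not_determine_state :
    ∃ ρ σ : Matrix (Fin 2) (Fin 2) ℂ,
      ρ.PosSemidef ∧ ρ.trace = 1 ∧ σ.PosSemidef ∧ σ.trace = 1 ∧ ρ ≠ σ ∧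
      symCovMat ρ pauliBasis = symCovMat σ pauliBasis := by
  refine ⟨diagonal ![1, 0], diagonal ![0, 1], ?_, ?_, ?_, ?_, ?_, ?_⟩
  · rw [posSemidef_diagonal_iff]
    intro i
    fin_cases i <;> simp
  · simp
  · rw [posSemidef_diagonal_iff]
    intro i
    fin_cases i <;> simp
  · simp
  · intro h
    simpa using congrFun (congrFun h 0) 0
  · ext i j
    fin_cases i <;> fin_cases j <;>
      simp [symCovMat, expVal, pauliBasis, trace_fin_two, mul_apply, Fin.sum_univ_two,
        diagonal_apply, one_apply] <;>
      try ring
end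
end

section
/- Let (G_k)_{k=1,…,d²} be d² Hermitian d×d complex matrices with tr(G_i G_j) = δ_{i,j} (a tomographically complete orthonormal family), and let ρ = v vᴴ be a pure state given by a unit vector v ∈ ℂ^d. Then the covariance matrix γ = γ(ρ,{G_k}) satisfies: (i) γ² = γ; (ii) tr(γ) = d − 1; consequently rank(γ) = d − 1 and every nonzero eigenvalue of γ equals 1. -/
open Matrix BigOperators
open scoped ComplexOrder

noncomputable section

/-- The completeness relation `∑ k, (G k) a b * (G k) c e = δ_{ae} δ_{bc}` of a trace-orthonormal
family of full cardinality. -/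
lemma sum_apply_mul_apply_of_trace_orthonormal {n ι : Type*} [Fintype n] [DecidableEq n]
    [Fintype ι] [DecidableEq ι] (hcard : Fintype.card ι = Fintype.card n ^ 2)
    (G : ι → Matrix n n ℂ) (hON : ∀ i j, (G i * G j).trace = if i = j then 1 else 0)
    (a b c e : n) :
    ∑ k, G k a b * G k c e = if a = e ∧ b = c then 1 else 0 := by
  let U : Matrix ι (n × n) ℂ := Matrix.of fun k p => G k p.1 p.2
  let V : Matrix (n × n) ι ℂ := Matrix.of fun p k => G k p.2 p.1
  have hUV : U * V = 1 := by
    ext i j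
    rw [Matrix.one_apply, ← hON i j]
    simp [U, V, Matrix.mul_apply, Matrix.trace, Fintype.sum_prod_type]
  have hVU : V * U = 1 :=
    (Matrix.mul_eq_one_comm_of_card_eq _ _ _ (by simp [hcard, sq])).mp hUV
  have h := congrFun (congrFun hVU (b, a)) (c, e)
  simpa [U, V, Matrix.mul_apply, Matrix.one_apply, and_comm] using h

/-- The rank of an idempotent complex matrix is its trace. -/
lemma trace_eq_rank_of_mul_self_eq {ι : Type*} [Fintype ι] [DecidableEq ι] {P : Matrix ι ι ℂ}
    (hP : P * P = P) : P.trace = P.rank := by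
  have h : IsIdempotentElem P.toLin' := by
    rw [IsIdempotentElem, Module.End.mul_eq_comp, ← Matrix.toLin'_mul, hP]
  have h2 := (LinearMap.IsIdempotentElem.isProj_range _ h).trace
  rw [Matrix.trace_toLin'_eq] at h2
  exact h2

/-- Factorization of the covariance matrix of a pure state through the projection onto the
orthogonal complement of the state vector. -/
lemma covMat_vecMulVec_eq_mul {n ι : Type*} [Fintype n] [DecidableEq n] [Fintype ι]
    (G : ι → Matrix n n ℂ) (v : n → ℂ) :
    covMat (vecMulVec v (star v)) G
      = (Matrix.of fun i => star v ᵥ* G i) *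
        ((1 - vecMulVec v (star v)) * (Matrix.of fun i => G i *ᵥ v)ᵀ) := by
  have hE (X : Matrix n n ℂ) : expVal (vecMulVec v (star v)) X = star v ⬝ᵥ X *ᵥ v := by
    rw [expVal, vecMulVec_mul, trace_vecMulVec, dotProduct_comm, ← dotProduct_mulVec]
  ext i j
  rw [Matrix.sub_mul, Matrix.mul_sub, Matrix.one_mul, vecMulVec_mul, mul_vecMulVec,
    Matrix.sub_apply, vecMulVec_apply]
  simp only [covMat, Matrix.of_apply, hE]
  congr 1
  · rw [← mulVec_mulVec, dotProduct_mulVec]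
    rfl
  · rw [dotProduct_mulVec]
    rfl

/-- For a unit vector `v` and a complete trace-orthonormal family `G`, the operator
`∑ k, G k v vᴴ G k` is the identity. -/
lemma mulVec_mul_vecMul_of_trace_orthonormal {n ι : Type*} [Fintype n] [DecidableEq n]
    [Fintype ι] [DecidableEq ι] (hcard : Fintype.card ι = Fintype.card n ^ 2)
    (G : ι → Matrix n n ℂ) (hON : ∀ i j, (G i * G j).trace = if i = j then 1 else 0)
    (v : n → ℂ) (hv : star v ⬝ᵥ v = 1) :
    (Matrix.of fun i => G i *ᵥ v)ᵀ * (Matrix.of fun i => star v ᵥ* G i) = 1 := by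
  ext a e
  calc ∑ k, (∑ b, G k a b * v b) * (∑ c, star v c * G k c e)
      = ∑ b, ∑ c, (v b * star v c) * ∑ k, G k a b * G k c e := by
        simp_rw [Finset.sum_mul_sum, Finset.mul_sum]
        rw [Finset.sum_comm]
        refine Finset.sum_congr rfl fun b _ => ?_
        rw [Finset.sum_comm]
        refine Finset.sum_congr rfl fun c _ => Finset.sum_congr rfl fun k _ => ?_
        ring
    _ = (if a = e then 1 else 0) * (star v ⬝ᵥ v) := by
        simp_rw [sum_apply_mul_apply_of_trace_orthonormal hcard G hON]
        by_cases h : a = e <;> simp [h, dotProduct, mul_comm]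
    _ = (1 : Matrix n n ℂ) a e := by rw [hv, mul_one, Matrix.one_apply]

/-- For a pure state, the covariance matrix of a tomographically complete
orthonormal family is a projection: γ² = γ, tr γ = d − 1, hence
rank γ = d − 1 and every nonzero eigenvalue of γ equals 1. -/
theorem covMat_pure_state {d : ℕ}
    (G : Fin (d ^ 2) → Matrix (Fin d) (Fin d) ℂ)
    (hHerm : ∀ k, (G k).IsHermitian)
    (hON : ∀ i j, (G i * G j).trace = if i = j then 1 else 0)
    (v : Fin d → ℂ) (hv : star v ⬝ᵥ v = 1) :
    covMat (vecMulVec v (star v)) G * covMat (vecMulVec v (star v)) G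
        = covMat (vecMulVec v (star v)) G ∧
    (covMat (vecMulVec v (star v)) G).trace = (d : ℂ) - 1 ∧
    (covMat (vecMulVec v (star v)) G).rank = d - 1 ∧
    (∀ (c : ℂ) (w : Fin (d ^ 2) → ℂ), w ≠ 0 →
      covMat (vecMulVec v (star v)) G *ᵥ w = c • w → c ≠ 0 → c = 1) := by
  set γ := covMat (vecMulVec v (star v)) G with hγ
  set Q : Matrix (Fin d) (Fin d) ℂ := 1 - vecMulVec v (star v) with hQ
  set A : Matrix (Fin (d ^ 2)) (Fin d) ℂ := Matrix.of fun i => star v ᵥ* G i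
  set B : Matrix (Fin d) (Fin (d ^ 2)) ℂ := (Matrix.of fun i => G i *ᵥ v)ᵀ
  have hfac : γ = A * (Q * B) := covMat_vecMulVec_eq_mul G v
  have hBA : B * A = 1 := mulVec_mul_vecMul_of_trace_orthonormal (by simp) G hON v hv
  have hQQ : Q * Q = Q := by
    have : IsIdempotentElem (vecMulVec v (star v)) := by
      rw [IsIdempotentElem, vecMulVec_mul_vecMulVec, hv, one_smul]
    exact this.one_sub
  have hidem : γ * γ = γ := by
    calc γ * γ = A * (Q * ((B * A) * (Q * B))) := by simp only [hfac, Matrix.mul_assoc]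
      _ = γ := by rw [hBA, Matrix.one_mul, ← Matrix.mul_assoc Q, hQQ, hfac]
  have htr : γ.trace = (d : ℂ) - 1 := by
    rw [hfac, Matrix.trace_mul_comm, Matrix.mul_assoc, hBA, Matrix.mul_one, hQ,
      Matrix.trace_sub, trace_vecMulVec, dotProduct_comm, hv, Matrix.trace_one, Fintype.card_fin]
  refine ⟨hidem, htr, ?_, fun c w hw hcw hc => ?_⟩
  · have h : ((γ.rank + 1 : ℕ) : ℂ) = d := by
      push_cast
      rw [← trace_eq_rank_of_mul_self_eq hidem, htr, sub_add_cancel]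
    have := Nat.cast_injective h
    omega
  · have h : (c * c) • w = c • w := by
      rw [← hcw, ← hidem, ← mulVec_mulVec, hcw, mulVec_smul, hcw, smul_smul]
    exact mul_left_cancel₀ hc ((smul_left_injective ℂ hw h).trans (mul_one c).symm)
end
end

section
/- Let (G_k)_{k=1,…,d²} be d² Hermitian d×d complex matrices with tr(G_i G_j) = δ_{i,j}, and let ρ = v vᴴ be a pure state given by a unit vector v ∈ ℂ^d. Then the symmetric covariance matrix γ^S = γ^S(ρ,{G_k}) satisfies: (i) 2(γ^S)² = γ^S, so every nonzero eigenvalue of γ^S equals 1/2; (ii) tr(γ^S) = d − 1; consequently rank(γ^S) = 2(d − 1). -/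
open Matrix BigOperators
open scoped ComplexOrder

noncomputable section

namespace OrthonormalMatrixBasis

variable {n ι : Type*} [Fintype n] [DecidableEq n] [Fintype ι] [DecidableEq ι]
  {G : ι → Matrix n n ℂ}

/-- Completeness relation of a trace-orthonormal family of `(card n)²` matrices. -/
theorem sum_apply_mul_apply (hcard : Fintype.card ι = Fintype.card n ^ 2)
    (hON : ∀ i j, (G i * G j).trace = if i = j then 1 else 0) (a b c e : n) :
    ∑ k, G k a b * G k c e = if a = e ∧ b = c then 1 else 0 := by
  let Q : Matrix ι (n × n) ℂ := Matrix.of fun k p => G k p.1 p.2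
  let P : Matrix (n × n) ι ℂ := Matrix.of fun p k => G k p.2 p.1
  have hQP : Q * P = 1 := by
    ext i j
    rw [Matrix.one_apply, ← hON i j, Matrix.trace, Matrix.mul_apply, Fintype.sum_prod_type]
    simp [Q, P, Matrix.mul_apply]
  have hPQ : P * Q = 1 := by
    refine (Matrix.mul_eq_one_comm_of_card_eq _ _ _ ?_).mp hQP
    simp [hcard, sq]
  have h := congrFun (congrFun hPQ (b, a)) (c, e)
  simpa [Matrix.mul_apply, P, Q, Matrix.one_apply, and_comm] using h

theorem sum_trace_smul (hcard : Fintype.card ι = Fintype.card n ^ 2)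
    (hON : ∀ i j, (G i * G j).trace = if i = j then 1 else 0) (Y : Matrix n n ℂ) :
    ∑ k, (G k * Y).trace • G k = Y := by
  ext c e
  have key : ∀ k, (G k * Y).trace * G k c e = ∑ a, ∑ b, Y b a * (G k a b * G k c e) := fun k => by
    simp only [Matrix.trace, Matrix.diag, Matrix.mul_apply, Finset.sum_mul]
    exact Finset.sum_congr rfl fun _ _ => Finset.sum_congr rfl fun _ _ => by ring
  simp only [Matrix.sum_apply, Matrix.smul_apply, smul_eq_mul, key]
  rw [Finset.sum_comm]
  simp_rw [Finset.sum_comm (s := (Finset.univ : Finset ι)), ← Finset.mul_sum,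
    sum_apply_mul_apply hcard hON, ite_and]
  simp

theorem sum_trace_mul_trace (hcard : Fintype.card ι = Fintype.card n ^ 2)
    (hON : ∀ i j, (G i * G j).trace = if i = j then 1 else 0) (X Y : Matrix n n ℂ) :
    ∑ k, (X * G k).trace * (G k * Y).trace = (X * Y).trace := by
  conv_rhs => rw [← sum_trace_smul hcard hON Y]
  simp [Matrix.mul_sum, Matrix.trace_sum, mul_comm]

theorem sum_mul_self (hcard : Fintype.card ι = Fintype.card n ^ 2)
    (hON : ∀ i j, (G i * G j).trace = if i = j then 1 else 0) :
    ∑ k, G k * G k = (Fintype.card n : ℂ) • (1 : Matrix n n ℂ) := by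
  ext a e
  simp only [Matrix.sum_apply, Matrix.mul_apply]
  rw [Finset.sum_comm]
  simp [sum_apply_mul_apply hcard hON, Matrix.one_apply]

end OrthonormalMatrixBasis

/-- The superoperator representing the symmetric covariance of a pure state `ρ`. -/
def covSuperop {n : Type*} [Fintype n] (ρ Y : Matrix n n ℂ) : Matrix n n ℂ :=
  (1 / 2 : ℂ) • (Y * ρ + ρ * Y) - ρ * Y * ρ

theorem two_smul_covSuperop_covSuperop {n : Type*} [Fintype n] {ρ : Matrix n n ℂ}
    (hρ : ρ * ρ = ρ) (Y : Matrix n n ℂ) :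
    (2 : ℂ) • covSuperop ρ (covSuperop ρ Y) = covSuperop ρ Y := by
  have hl : ∀ Z : Matrix n n ℂ, ρ * (ρ * Z) = ρ * Z := fun Z => by rw [← Matrix.mul_assoc, hρ]
  simp only [covSuperop, Matrix.mul_assoc, Matrix.mul_add, Matrix.add_mul, Matrix.mul_sub,
    Matrix.sub_mul, Matrix.mul_smul, Matrix.smul_mul, hl, hρ]
  module

theorem trace_covSuperop_mul {n : Type*} [Fintype n] (ρ X Y : Matrix n n ℂ) :
    (covSuperop ρ X * Y).trace = (X * covSuperop ρ Y).trace := by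
  have h1 : (ρ * (X * Y)).trace = (X * (Y * ρ)).trace := by
    rw [Matrix.trace_mul_comm, Matrix.mul_assoc]
  have h2 : (ρ * (X * (ρ * Y))).trace = (X * (ρ * (Y * ρ))).trace := by
    rw [Matrix.trace_mul_comm]
    simp only [Matrix.mul_assoc]
  simp only [covSuperop, Matrix.mul_sub, Matrix.sub_mul, Matrix.mul_smul, Matrix.smul_mul,
    Matrix.mul_add, Matrix.add_mul, Matrix.trace_sub, Matrix.trace_smul, Matrix.trace_add,
    Matrix.mul_assoc, h1, h2]
  rw [add_comm]

/-- The rank of an idempotent matrix over a field is its trace. -/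
theorem rank_eq_trace_of_isIdempotentElem {K ι : Type*} [Field K] [Fintype ι] [DecidableEq ι]
    {A : Matrix ι ι K} (hA : IsIdempotentElem A) : (A.rank : K) = A.trace := by
  have h : IsIdempotentElem (Matrix.toLin' A) := by
    rw [IsIdempotentElem, Module.End.mul_eq_comp, ← Matrix.toLin'_mul, hA.eq]
  rw [← Matrix.trace_toLin'_eq, (LinearMap.IsIdempotentElem.isProj_range _ h).trace]
  rfl

section PureState

variable {n : Type*} [Fintype n] {v : n → ℂ}

theorem vecMulVec_star_mul_self (hv : star v ⬝ᵥ v = 1) :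
    vecMulVec v (star v) * vecMulVec v (star v) = vecMulVec v (star v) := by
  simp [Matrix.vecMulVec_mul_vecMulVec, hv]

theorem vecMulVec_star_mul_mul (v : n → ℂ) (Y : Matrix n n ℂ) :
    vecMulVec v (star v) * Y * vecMulVec v (star v)
      = (vecMulVec v (star v) * Y).trace • vecMulVec v (star v) := by
  rw [Matrix.vecMulVec_mul, Matrix.vecMulVec_mul_vecMulVec, Matrix.trace_vecMulVec,
    dotProduct_comm]
  ext
  simp [Matrix.vecMulVec_apply, mul_left_comm]

theorem symCovMat_apply_eq_trace {ι : Type*} [Fintype ι] (v : n → ℂ)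
    (G : ι → Matrix n n ℂ) (i j : ι) :
    symCovMat (vecMulVec v (star v)) G i j
      = (G i * covSuperop (vecMulVec v (star v)) (G j)).trace := by
  rw [covSuperop, vecMulVec_star_mul_mul]
  generalize vecMulVec v (star v) = ρ
  have h1 : (ρ * (G i * G j)).trace = (G i * (G j * ρ)).trace := by
    rw [Matrix.trace_mul_comm, Matrix.mul_assoc]
  have h2 : (ρ * (G j * G i)).trace = (G i * (ρ * G j)).trace := by
    rw [← Matrix.mul_assoc, Matrix.trace_mul_comm]
  have h3 : (ρ * G i).trace = (G i * ρ).trace := Matrix.trace_mul_comm _ _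
  simp only [symCovMat, expVal, Matrix.of_apply, Matrix.mul_sub, Matrix.mul_smul, Matrix.mul_add,
    Matrix.trace_sub, Matrix.trace_smul, Matrix.trace_add, smul_eq_mul, h1, h2, h3]
  ring

end PureState

/-- For a pure state, the symmetric covariance matrix of a tomographically
complete orthonormal family satisfies 2(γ^S)² = γ^S (so every nonzero
eigenvalue equals 1/2), tr γ^S = d − 1, and rank γ^S = 2(d − 1). -/
theorem symCovMat_pure_state {d : ℕ}
    (G : Fin (d ^ 2) → Matrix (Fin d) (Fin d) ℂ)
    (hHerm : ∀ k, (G k).IsHermitian)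
    (hON : ∀ i j, (G i * G j).trace = if i = j then 1 else 0)
    (v : Fin d → ℂ) (hv : star v ⬝ᵥ v = 1) :
    (2 : ℂ) • (symCovMat (vecMulVec v (star v)) G * symCovMat (vecMulVec v (star v)) G)
        = symCovMat (vecMulVec v (star v)) G ∧
    (∀ (c : ℂ) (w : Fin (d ^ 2) → ℂ), w ≠ 0 →
      symCovMat (vecMulVec v (star v)) G *ᵥ w = c • w → c ≠ 0 → c = 1 / 2) ∧
    (symCovMat (vecMulVec v (star v)) G).trace = (d : ℂ) - 1 ∧
    (symCovMat (vecMulVec v (star v)) G).rank = 2 * (d - 1) := by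
  have hcard : Fintype.card (Fin (d ^ 2)) = Fintype.card (Fin d) ^ 2 := by simp
  have hρ := vecMulVec_star_mul_self hv
  have hγ := symCovMat_apply_eq_trace v G
  have htrρ : (vecMulVec v (star v)).trace = 1 := by
    rw [Matrix.trace_vecMulVec, dotProduct_comm, hv]
  generalize vecMulVec v (star v) = ρ at *
  have hsq : (2 : ℂ) • (symCovMat ρ G * symCovMat ρ G) = symCovMat ρ G := by
    ext i j
    have h : (symCovMat ρ G * symCovMat ρ G) i j
        = (G i * covSuperop ρ (covSuperop ρ (G j))).trace := by
      rw [Matrix.mul_apply, ← trace_covSuperop_mul,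
        ← OrthonormalMatrixBasis.sum_trace_mul_trace hcard hON]
      simp only [hγ, trace_covSuperop_mul]
    rw [Matrix.smul_apply, h, hγ, ← Matrix.trace_smul, ← Matrix.mul_smul,
      two_smul_covSuperop_covSuperop hρ]
  have htr : (symCovMat ρ G).trace = (d : ℂ) - 1 := by
    have h1 : ∑ i, expVal ρ (G i * G i) = d := by
      simp only [expVal, ← Matrix.trace_sum, ← Matrix.mul_sum,
        OrthonormalMatrixBasis.sum_mul_self hcard hON]
      simp [htrρ]
    have h2 : ∑ i, expVal ρ (G i) * expVal ρ (G i) = 1 := by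
      have h := OrthonormalMatrixBasis.sum_trace_mul_trace hcard hON ρ ρ
      rw [hρ, htrρ] at h
      simpa only [expVal, Matrix.trace_mul_comm (G _) ρ] using h
    simp only [Matrix.trace, Matrix.diag, symCovMat, Matrix.of_apply, add_self_div_two,
      Finset.sum_sub_distrib, h1, h2]
  refine ⟨hsq, fun c w hw hcw hc => ?_, htr, ?_⟩
  · have h := congrArg (· *ᵥ w) hsq
    simp only [Matrix.smul_mulVec, ← Matrix.mulVec_mulVec, hcw, Matrix.mulVec_smul, smul_smul] at h
    have h' := mul_left_cancel₀ hc (b := 2 * c) (c := 1) (by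
      linear_combination smul_left_injective ℂ hw h)
    linear_combination h' / 2
  · have hidem : IsIdempotentElem ((2 : ℂ) • symCovMat ρ G) := by
      rw [IsIdempotentElem, Matrix.smul_mul, Matrix.mul_smul, hsq]
    have hrank := rank_eq_trace_of_isIdempotentElem hidem
    rw [Matrix.rank_smul_of_mem_nonZeroDivisors _ (mem_nonZeroDivisors_of_ne_zero two_ne_zero),
      Matrix.trace_smul, htr, smul_eq_mul] at hrank
    have hd : 1 ≤ d := by
      rcases Nat.eq_zero_or_pos d with rfl | h
      · simp at hv
      · exact h
    have : (((symCovMat ρ G).rank : ℕ) : ℂ) = ((2 * (d - 1) : ℕ) : ℂ) := by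
      rw [hrank]; push_cast [hd]; ring
    exact_mod_cast this
end
end

section
/- Let (M_k)_{k=1,…,d²} be d² Hermitian d×d complex matrices with tr(M_i M_j) = δ_{i,j}, and let ρ be a density matrix on ℂ^d. Then tr(γ(ρ,{M_k})) = d − tr(ρ²), and consequently d − 1 ≤ tr(γ(ρ,{M_k})) ≤ d − 1/d. The same identity and bounds hold for the symmetric covariance matrix γ^S(ρ,{M_k}), since tr(γ) = tr(γ^S). -/
open Matrix BigOperators
open scoped ComplexOrder

noncomputable section

/-- A family of `d ^ 2` Hilbert–Schmidt orthonormal matrices is complete. -/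
lemma sum_apply_mul_apply_of_trace_eq {d : ℕ} {M : Fin (d ^ 2) → Matrix (Fin d) (Fin d) ℂ}
    (hON : ∀ i j, (M i * M j).trace = if i = j then 1 else 0) (a b a' b' : Fin d) :
    ∑ k, M k b a * M k a' b' = if a = a' ∧ b = b' then 1 else 0 := by
  let A : Matrix (Fin (d ^ 2)) (Fin d × Fin d) ℂ := Matrix.of fun k p => M k p.1 p.2
  let B : Matrix (Fin d × Fin d) (Fin (d ^ 2)) ℂ := Matrix.of fun p k => M k p.2 p.1
  have hAB : A * B = 1 := by
    ext i j
    rw [Matrix.one_apply, ← hON i j]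
    simp [A, B, Matrix.mul_apply, Matrix.trace, Fintype.sum_prod_type]
  have hBA : B * A = 1 :=
    (Matrix.mul_eq_one_comm_of_card_eq _ _ _ (by simp [sq])).mp hAB
  have h := congrFun (congrFun hBA (a, b)) (a', b')
  simpa [A, B, Matrix.mul_apply, Matrix.one_apply] using h

lemma sum_mul_self_of_trace_eq {d : ℕ} {M : Fin (d ^ 2) → Matrix (Fin d) (Fin d) ℂ}
    (hON : ∀ i j, (M i * M j).trace = if i = j then 1 else 0) :
    ∑ k, M k * M k = (d : ℂ) • (1 : Matrix (Fin d) (Fin d) ℂ) := by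
  ext x y
  simp only [Matrix.sum_apply, Matrix.mul_apply]
  rw [Finset.sum_comm]
  simp [sum_apply_mul_apply_of_trace_eq hON, Matrix.one_apply]

lemma sum_expVal_mul_self_of_trace_eq {d : ℕ} {M : Fin (d ^ 2) → Matrix (Fin d) (Fin d) ℂ}
    (hON : ∀ i j, (M i * M j).trace = if i = j then 1 else 0) (ρ : Matrix (Fin d) (Fin d) ℂ) :
    ∑ k, expVal ρ (M k) * expVal ρ (M k) = (ρ * ρ).trace := by
  have h : ∀ k, expVal ρ (M k) * expVal ρ (M k) =
      ∑ a, ∑ b, ∑ c, ∑ e, ρ a b * ρ c e * (M k b a * M k e c) := by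
    intro k
    simp only [expVal, Matrix.trace, Matrix.diag, Matrix.mul_apply, Finset.sum_mul]
    simp only [Finset.mul_sum]
    refine Finset.sum_congr rfl fun a _ => Finset.sum_congr rfl fun b _ =>
      Finset.sum_congr rfl fun c _ => Finset.sum_congr rfl fun e _ => by ring
  simp only [h]
  rw [Finset.sum_comm]
  simp only [Matrix.trace, Matrix.diag, Matrix.mul_apply]
  refine Finset.sum_congr rfl fun a _ => ?_
  rw [Finset.sum_comm]
  refine Finset.sum_congr rfl fun b _ => ?_
  rw [Finset.sum_comm]
  have h2 : ∀ c, ∑ k, ∑ e, ρ a b * ρ c e * (M k b a * M k e c) =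
      if b = c then ρ a b * ρ c a else 0 := by
    intro c
    rw [Finset.sum_comm]
    simp only [← Finset.mul_sum, sum_apply_mul_apply_of_trace_eq hON]
    by_cases hbc : b = c <;> simp [hbc]
  simp [h2]

lemma trace_covMat_eq {d : ℕ} {M : Fin (d ^ 2) → Matrix (Fin d) (Fin d) ℂ}
    (hON : ∀ i j, (M i * M j).trace = if i = j then 1 else 0)
    {ρ : Matrix (Fin d) (Fin d) ℂ} (hρ1 : ρ.trace = 1) :
    (covMat ρ M).trace = (d : ℂ) - (ρ * ρ).trace := by
  have h : ∑ k, expVal ρ (M k * M k) = d := by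
    simp only [expVal]
    rw [← Matrix.trace_sum, ← Matrix.mul_sum, sum_mul_self_of_trace_eq hON]
    simp [hρ1]
  rw [← sum_expVal_mul_self_of_trace_eq hON ρ, ← h, ← Finset.sum_sub_distrib]
  rfl

lemma trace_symCovMat {n ι : Type*} [Fintype n] [Fintype ι]
    (ρ : Matrix n n ℂ) (M : ι → Matrix n n ℂ) :
    (symCovMat ρ M).trace = (covMat ρ M).trace := by
  simp [symCovMat, covMat, Matrix.trace]

lemma Matrix.IsHermitian.trace_mul_self {n : Type*} [Fintype n] [DecidableEq n]
    {A : Matrix n n ℂ} (hA : A.IsHermitian) :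
    (A * A).trace = ((∑ i, hA.eigenvalues i ^ 2 : ℝ) : ℂ) := by
  conv_lhs => rw [hA.spectral_theorem, ← map_mul, Unitary.conjStarAlgAut_apply,
    Matrix.trace_mul_cycle]
  simp [Matrix.trace, sq]

/-- The purity of a density matrix lies between `1 / d` and `1`. -/
lemma Matrix.PosSemidef.purity_bounds {n : Type*} [Fintype n] [DecidableEq n]
    {ρ : Matrix n n ℂ} (hρ : ρ.PosSemidef) (hρ1 : ρ.trace = 1) :
    1 / (Fintype.card n : ℝ) ≤ (ρ * ρ).trace.re ∧ (ρ * ρ).trace.re ≤ 1 := by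
  have hsum : ∑ i, hρ.isHermitian.eigenvalues i = 1 := by
    have h := hρ.isHermitian.trace_eq_sum_eigenvalues
    rw [hρ1] at h
    apply Complex.ofReal_injective
    rw [Complex.ofReal_sum, Complex.ofReal_one]
    exact h.symm
  rw [hρ.isHermitian.trace_mul_self, Complex.ofReal_re]
  constructor
  · have h := sq_sum_le_card_mul_sum_sq (s := Finset.univ) (f := hρ.isHermitian.eigenvalues)
    rw [hsum, one_pow, Finset.card_univ] at h
    exact div_le_of_le_mul₀ (Nat.cast_nonneg _) (Finset.sum_nonneg fun i _ => sq_nonneg _)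
      (by rwa [mul_comm])
  · have h := Finset.sum_sq_le_sq_sum_of_nonneg (s := Finset.univ) (f := hρ.isHermitian.eigenvalues)
      fun i _ => hρ.eigenvalues_nonneg i
    rwa [hsum, one_pow] at h

/-- The trace of a covariance matrix over a Hilbert–Schmidt orthonormal basis
of observables equals d − tr(ρ²), whence d − 1 ≤ tr γ ≤ d − 1/d. The same
identity and bounds hold for the symmetric covariance matrix. -/
theorem trace_covMat {d : ℕ}
    (M : Fin (d ^ 2) → Matrix (Fin d) (Fin d) ℂ)
    (hHerm : ∀ k, (M k).IsHermitian)
    (hON : ∀ i j, (M i * M j).trace = if i = j then 1 else 0)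
    (ρ : Matrix (Fin d) (Fin d) ℂ) (hρ : ρ.PosSemidef) (hρ1 : ρ.trace = 1) :
    (covMat ρ M).trace = (d : ℂ) - (ρ * ρ).trace ∧
    (symCovMat ρ M).trace = (d : ℂ) - (ρ * ρ).trace ∧
    ((d : ℝ) - 1 ≤ (covMat ρ M).trace.re ∧
      (covMat ρ M).trace.re ≤ (d : ℝ) - 1 / (d : ℝ)) ∧
    ((d : ℝ) - 1 ≤ (symCovMat ρ M).trace.re ∧
      (symCovMat ρ M).trace.re ≤ (d : ℝ) - 1 / (d : ℝ)) := by
  have h1 := trace_covMat_eq hON hρ1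
  obtain ⟨hlo, hhi⟩ := hρ.purity_bounds hρ1
  rw [Fintype.card_fin] at hlo
  rw [trace_symCovMat, h1, Complex.sub_re, Complex.natCast_re]
  exact ⟨rfl, rfl, ⟨by linarith, by linarith⟩, ⟨by linarith, by linarith⟩⟩
end
end

section
/- Let (M_k)_{k=1,…,N} be Hermitian d×d complex matrices with tr(M_i M_j) = δ_{i,j}, and let ρ be a density matrix on ℂ^d. Let 𝔤(ρ) be the N×N matrix with entries 𝔤_{i,j} = tr(ρ M_i M_j) and γ(ρ) the covariance matrix with entries γ_{i,j} = tr(ρ M_i M_j) − tr(ρ M_i) tr(ρ M_j). Then the operator norms (largest eigenvalues of these positive semidefinite Hermitian matrices) satisfy ‖𝔤(ρ)‖ ≤ ‖ρ‖ and ‖γ(ρ)‖ ≤ ‖ρ‖, where ‖ρ‖ is the operator norm (largest eigenvalue) of ρ. -/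
open Matrix BigOperators
open scoped ComplexOrder

noncomputable section

/-- The linear part 𝔤 of a covariance matrix: 𝔤_{ij} = tr(ρ M_i M_j). -/
def gMat {n ι : Type*} [Fintype n] [Fintype ι]
    (ρ : Matrix n n ℂ) (M : ι → Matrix n n ℂ) : Matrix ι ι ℂ :=
  Matrix.of fun i j => expVal ρ (M i * M j)

namespace Matrix

lemma IsHermitian.posSemidef_smul_one_sub {n : Type*} [Fintype n] [DecidableEq n]
    {A : Matrix n n ℂ} (hA : A.IsHermitian) {c : ℝ} (hc : ∀ i, hA.eigenvalues i ≤ c) :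
    ((c : ℂ) • (1 : Matrix n n ℂ) - A).PosSemidef := by
  have hD : (diagonal fun i => ((c - hA.eigenvalues i : ℝ) : ℂ)).PosSemidef :=
    PosSemidef.diagonal fun i => by simpa using hc i
  have hU : (hA.eigenvectorUnitary : Matrix n n ℂ) * (hA.eigenvectorUnitary : Matrix n n ℂ)ᴴ = 1 :=
    Unitary.mul_star_self_of_mem hA.eigenvectorUnitary.2
  have key := hD.mul_mul_conjTranspose_same (hA.eigenvectorUnitary : Matrix n n ℂ)
  convert key using 1
  have hdiag : (diagonal fun i => ((c - hA.eigenvalues i : ℝ) : ℂ)) =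
      (c : ℂ) • (1 : Matrix n n ℂ) - diagonal (RCLike.ofReal ∘ hA.eigenvalues) := by
    ext i j
    by_cases h : i = j <;> simp [h]
  conv_lhs => rw [hA.spectral_theorem]
  rw [hdiag, mul_sub, sub_mul, mul_smul_comm, mul_one, smul_mul_assoc, hU]
  rfl

lemma IsHermitian.eigenvalues_le_of_posSemidef {n : Type*} [Fintype n] [DecidableEq n]
    {A : Matrix n n ℂ} (hA : A.IsHermitian) {c : ℝ}
    (h : ((c : ℂ) • (1 : Matrix n n ℂ) - A).PosSemidef) (i : n) : hA.eigenvalues i ≤ c := by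
  have hv : star (⇑(hA.eigenvectorBasis i)) ⬝ᵥ ⇑(hA.eigenvectorBasis i) = 1 := by
    rw [dotProduct_comm, ← EuclideanSpace.inner_eq_star_dotProduct,
      hA.eigenvectorBasis.inner_eq_one]
  have h0 := h.dotProduct_mulVec_nonneg (hA.eigenvectorBasis i)
  rw [sub_mulVec, hA.mulVec_eigenvectorBasis, smul_mulVec, one_mulVec, dotProduct_sub,
    dotProduct_smul, dotProduct_smul, hv] at h0
  simpa using h0

end Matrix

open scoped MatrixOrder in
lemma gMat_posSemidef {n ι : Type*} [Fintype n] [Fintype ι] {σ : Matrix n n ℂ}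
    (hσ : σ.PosSemidef) {M : ι → Matrix n n ℂ} (hM : ∀ k, (M k).IsHermitian) :
    (gMat σ M).PosSemidef := by
  classical
  obtain ⟨B, rfl⟩ := CStarAlgebra.nonneg_iff_eq_star_mul_self.mp hσ.nonneg
  have h : gMat (star B * B) M = (of fun (p : n × n) j => (M j * Bᴴ) p.1 p.2)ᴴ *
      (of fun (p : n × n) j => (M j * Bᴴ) p.1 p.2) := by
    rw [star_eq_conjTranspose]
    ext i j
    have hij : (Bᴴ * B * (M i * M j)).trace = ((M i * Bᴴ)ᴴ * (M j * Bᴴ)).trace := by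
      rw [conjTranspose_mul, conjTranspose_conjTranspose, (hM i).eq, mul_assoc, trace_mul_comm]
      simp only [mul_assoc]
    simp only [gMat, expVal, of_apply, hij]
    simp only [trace, diag_apply, mul_apply (M := (M i * Bᴴ)ᴴ), mul_apply (l := ι),
      conjTranspose_apply, of_apply, Fintype.sum_prod_type]
    exact Finset.sum_comm
  rw [h]
  exact posSemidef_conjTranspose_mul_self _

lemma smul_one_sub_gMat {n ι : Type*} [Fintype n] [DecidableEq n] [Fintype ι] [DecidableEq ι]
    {M : ι → Matrix n n ℂ} (hON : ∀ i j, (M i * M j).trace = if i = j then 1 else 0)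
    (ρ : Matrix n n ℂ) (c : ℂ) :
    c • (1 : Matrix ι ι ℂ) - gMat ρ M = gMat (c • (1 : Matrix n n ℂ) - ρ) M := by
  ext i j
  simp [gMat, expVal, sub_mul, hON, one_apply]

lemma star_expVal {n : Type*} [Fintype n] {ρ X : Matrix n n ℂ}
    (hρ : ρ.IsHermitian) (hX : X.IsHermitian) : star (expVal ρ X) = expVal ρ X := by
  rw [expVal, ← trace_conjTranspose, conjTranspose_mul, hρ.eq, hX.eq, trace_mul_comm]

lemma covMat_eq_gMat_sub_vecMulVec {n ι : Type*} [Fintype n] [Fintype ι] {ρ : Matrix n n ℂ}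
    (hρ : ρ.IsHermitian) {M : ι → Matrix n n ℂ} (hM : ∀ k, (M k).IsHermitian) :
    covMat ρ M = gMat ρ M -
      vecMulVec (fun k => expVal ρ (M k)) (star fun k => expVal ρ (M k)) := by
  ext i j
  simp only [covMat, gMat, of_apply, Matrix.sub_apply, vecMulVec_apply, Pi.star_apply,
    star_expVal hρ (hM j)]

/-- Operator norm bound: the largest eigenvalue of the (positive semidefinite
Hermitian) matrices 𝔤(ρ) and γ(ρ) is bounded by the largest eigenvalue of ρ. -/
theorem covMat_opNorm_bound {d N : ℕ} (hd : 0 < d)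
    (M : Fin N → Matrix (Fin d) (Fin d) ℂ)
    (hHerm : ∀ k, (M k).IsHermitian)
    (hON : ∀ i j, (M i * M j).trace = if i = j then 1 else 0)
    (ρ : Matrix (Fin d) (Fin d) ℂ) (hρ : ρ.PosSemidef) (hρ1 : ρ.trace = 1)
    (hg : (gMat ρ M).IsHermitian) (hγ : (covMat ρ M).IsHermitian) :
    (∀ i, hg.eigenvalues i ≤
        Finset.univ.sup' ⟨(⟨0, hd⟩ : Fin d), Finset.mem_univ _⟩ hρ.1.eigenvalues) ∧
    (∀ i, hγ.eigenvalues i ≤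
        Finset.univ.sup' ⟨(⟨0, hd⟩ : Fin d), Finset.mem_univ _⟩ hρ.1.eigenvalues) := by
  have hc := hρ.1.posSemidef_smul_one_sub (c := Finset.univ.sup' ⟨⟨0, hd⟩, Finset.mem_univ _⟩ _)
    fun i => Finset.le_sup' hρ.1.eigenvalues (Finset.mem_univ i)
  have hgc := gMat_posSemidef hc hHerm
  rw [← smul_one_sub_gMat hON] at hgc
  refine ⟨hg.eigenvalues_le_of_posSemidef hgc, hγ.eigenvalues_le_of_posSemidef ?_⟩
  rw [covMat_eq_gMat_sub_vecMulVec hρ.1 hHerm, ← sub_add]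
  exact hgc.add (posSemidef_vecMulVec_self_star _)
end
end

section
/- Let ρ be a density matrix on ℂ^{d_A} ⊗ ℂ^{d_B}, let (A_i)_{i=1,…,d_A²} and (B_j)_{j=1,…,d_B²} be Hilbert–Schmidt orthonormal families of Hermitian matrices on the two factors (d_A² respectively d_B² members, hence bases of the Hermitian matrices), and let γ be the block covariance matrix of ρ with respect to the observables {A_i ⊗ 1} ∪ {1 ⊗ B_j}. If γ = γᵀ, then both reduced states of ρ are maximally mixed; that is, tr(ρ (A_i ⊗ 1)) = tr(A_i)/d_A for all i and tr(ρ (1 ⊗ B_j)) = tr(B_j)/d_B for all j. -/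
open Matrix BigOperators
open scoped ComplexOrder Kronecker

noncomputable section

/-- A family of `d ^ 2` matrices of size `d`, orthonormal for the trace form, spans all matrices. -/
theorem span_range_eq_top_of_trace_mul {d : ℕ} (A : Fin (d ^ 2) → Matrix (Fin d) (Fin d) ℂ)
    (hA : ∀ i j, (A i * A j).trace = if i = j then 1 else 0) :
    Submodule.span ℂ (Set.range A) = ⊤ := by
  have hli : LinearIndependent ℂ A := by
    rw [Fintype.linearIndependent_iff]
    intro g hg i
    have h := congrArg (fun X => (X * A i).trace) hg
    simpa [Finset.sum_mul, trace_sum, hA] using h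
  apply hli.span_eq_top_of_card_eq_finrank'
  simp [Module.finrank_matrix, sq]

/-- A linear functional on square matrices that vanishes on commutators is a multiple of the
trace. -/
theorem card_mul_eq_mul_trace_of_map_mul_comm {R n : Type*} [CommRing R] [Fintype n]
    [DecidableEq n] (f : Matrix n n R →ₗ[R] R) (hf : ∀ X Y, f (X * Y) = f (Y * X))
    (X : Matrix n n R) : Fintype.card n * f X = f 1 * X.trace := by
  suffices h : (Fintype.card n : R) • f = f 1 • traceLinearMap n R R by
    simpa using LinearMap.congr_fun h X
  apply Matrix.ext_linearMap
  intro i j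
  ext
  have h : ∀ k, f (single i j 1) = f (single k j 1 * single i k 1) := fun k => by
    rw [← hf, single_mul_single_same, one_mul]
  have hsum : (Fintype.card n : R) * f (single i j 1)
      = f (∑ k, single k j (1 : R) * single i k 1) := by
    rw [map_sum, ← Finset.sum_congr rfl fun k _ => h k]
    simp
  by_cases hij : i = j
  · subst hij
    simpa [sum_single_one] using hsum
  · have h0 : ∀ k, single k j (1 : R) * single i k 1 = 0 := fun k =>
      single_mul_single_of_ne _ _ _ _ (Ne.symm hij) _
    simpa [h0, trace_single_eq_of_ne _ _ _ hij] using hsum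

/-- A normalized linear functional that is symmetric on products of members of a trace-orthonormal
basis is the normalized trace. -/
theorem eq_trace_div_of_map_mul_comm {d : ℕ} (hd : d ≠ 0)
    (A : Fin (d ^ 2) → Matrix (Fin d) (Fin d) ℂ)
    (hA : ∀ i j, (A i * A j).trace = if i = j then 1 else 0)
    (f : Matrix (Fin d) (Fin d) ℂ →ₗ[ℂ] ℂ) (hf1 : f 1 = 1)
    (hf : ∀ i j, f (A i * A j) = f (A j * A i)) (X : Matrix (Fin d) (Fin d) ℂ) :
    f X = X.trace / d := by
  have hspan := span_range_eq_top_of_trace_mul A hA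
  have hbilin : (LinearMap.mul ℂ (Matrix (Fin d) (Fin d) ℂ)).compr₂ f
      = ((LinearMap.mul ℂ (Matrix (Fin d) (Fin d) ℂ)).flip).compr₂ f := by
    apply LinearMap.ext_on_range hspan
    intro i
    apply LinearMap.ext_on_range hspan
    intro j
    exact hf i j
  have h := card_mul_eq_mul_trace_of_map_mul_comm f
    (fun Y Z => LinearMap.congr_fun (LinearMap.congr_fun hbilin Y) Z) X
  rw [Fintype.card_fin, hf1, one_mul] at h
  rw [eq_div_iff (Nat.cast_ne_zero.mpr hd), mul_comm, h]

/-- If the block covariance matrix of a bipartite state with respect to local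
orthonormal Hermitian bases is symmetric (γ = γᵀ), then both reduced states
are maximally mixed: ⟨A_i ⊗ 1⟩ = tr(A_i)/d_A and ⟨1 ⊗ B_j⟩ = tr(B_j)/d_B. -/
theorem symmetric_blockCovMat_maximally_mixed {dA dB : ℕ}
    (ρ : Matrix (Fin dA × Fin dB) (Fin dA × Fin dB) ℂ)
    (hρ : ρ.PosSemidef) (hρ1 : ρ.trace = 1)
    (A : Fin (dA ^ 2) → Matrix (Fin dA) (Fin dA) ℂ)
    (hAH : ∀ i, (A i).IsHermitian)
    (hAON : ∀ i j, (A i * A j).trace = if i = j then 1 else 0)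
    (B : Fin (dB ^ 2) → Matrix (Fin dB) (Fin dB) ℂ)
    (hBH : ∀ j, (B j).IsHermitian)
    (hBON : ∀ i j, (B i * B j).trace = if i = j then 1 else 0)
    (hsym : covMat ρ (Sum.elim (fun i => A i ⊗ₖ (1 : Matrix (Fin dB) (Fin dB) ℂ))
              (fun j => (1 : Matrix (Fin dA) (Fin dA) ℂ) ⊗ₖ B j))
          = (covMat ρ (Sum.elim (fun i => A i ⊗ₖ (1 : Matrix (Fin dB) (Fin dB) ℂ))
              (fun j => (1 : Matrix (Fin dA) (Fin dA) ℂ) ⊗ₖ B j)))ᵀ) :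
    (∀ i, (ρ * (A i ⊗ₖ (1 : Matrix (Fin dB) (Fin dB) ℂ))).trace = (A i).trace / dA) ∧
    (∀ j, (ρ * ((1 : Matrix (Fin dA) (Fin dA) ℂ) ⊗ₖ B j)).trace = (B j).trace / dB) := by
  have hdA : dA ≠ 0 := by
    rintro rfl
    simp [Matrix.trace] at hρ1
  have hdB : dB ≠ 0 := by
    rintro rfl
    simp [Matrix.trace] at hρ1
  constructor
  · intro i
    let f : Matrix (Fin dA) (Fin dA) ℂ →ₗ[ℂ] ℂ :=
      { toFun := fun X => (ρ * (X ⊗ₖ (1 : Matrix (Fin dB) (Fin dB) ℂ))).trace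
        map_add' := fun X Y => by simp [add_kronecker, mul_add]
        map_smul' := fun c X => by simp [smul_kronecker] }
    refine eq_trace_div_of_map_mul_comm hdA A hAON f (by simp [f, hρ1]) (fun k l => ?_) (A i)
    have h := congrFun (congrFun hsym (Sum.inl k)) (Sum.inl l)
    simp only [covMat, expVal, transpose_apply, of_apply, Sum.elim_inl, ← mul_kronecker_mul,
      mul_one] at h
    simp only [f, LinearMap.coe_mk, AddHom.coe_mk]
    linear_combination h
  · intro j
    let f : Matrix (Fin dB) (Fin dB) ℂ →ₗ[ℂ] ℂ :=
      { toFun := fun X => (ρ * ((1 : Matrix (Fin dA) (Fin dA) ℂ) ⊗ₖ X)).trace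
        map_add' := fun X Y => by simp [kronecker_add, mul_add]
        map_smul' := fun c X => by simp [kronecker_smul] }
    refine eq_trace_div_of_map_mul_comm hdB B hBON f (by simp [f, hρ1]) (fun k l => ?_) (B j)
    have h := congrFun (congrFun hsym (Sum.inr k)) (Sum.inr l)
    simp only [covMat, expVal, transpose_apply, of_apply, Sum.elim_inr, ← mul_kronecker_mul,
      mul_one] at h
    simp only [f, LinearMap.coe_mk, AddHom.coe_mk]
    linear_combination h
end
end

section
/- (Schmidt CMC) Let d_A ≤ d_B, let (G_k^A)_{k=1,…,d_A²} be Hermitian d_A×d_A matrices with tr(G_k^A G_l^A) = δ_{k,l}, let (G_k^B)_{k=1,…,d_A²} be Hermitian d_B×d_B matrices with tr(G_k^B G_l^B) = δ_{k,l}, and let λ_k ≥ 0 be such that ρ = Σ_{k=1}^{d_A²} λ_k G_k^A ⊗ G_k^B is a separable density matrix (this is the Schmidt decomposition of ρ in operator space). Set g_k^A = tr(G_k^A) and g_k^B = tr(G_k^B). Then 2 Σ_k |λ_k − λ_k² g_k^A g_k^B| ≤ 2 − Σ_k λ_k² [(g_k^A)² + (g_k^B)²]. -/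
open Matrix BigOperators
open scoped ComplexOrder Kronecker

noncomputable section

/-- A bipartite state (tensor products realized by Kronecker products) is
separable if it is a convex combination of pure product states. -/
def Separable {dA dB : ℕ}
    (ρ : Matrix (Fin dA × Fin dB) (Fin dA × Fin dB) ℂ) : Prop :=
  ∃ (m : ℕ) (p : Fin m → ℝ) (a : Fin m → Fin dA → ℂ) (b : Fin m → Fin dB → ℂ),
    (∀ k, 0 ≤ p k) ∧ (∑ k, p k = 1) ∧
    (∀ k, star (a k) ⬝ᵥ a k = 1) ∧ (∀ k, star (b k) ⬝ᵥ b k = 1) ∧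
    ρ = ∑ k, (p k : ℂ) •
      (vecMulVec (a k) (star (a k)) ⊗ₖ vecMulVec (b k) (star (b k)))

/-- The trace of a product of two Hermitian matrices is real. -/
lemma Matrix.IsHermitian.ofReal_re_trace_mul {n : Type*} [Fintype n] {P G : Matrix n n ℂ}
    (hP : P.IsHermitian) (hG : G.IsHermitian) :
    (((P * G).trace.re : ℝ) : ℂ) = (P * G).trace := by
  rw [← Complex.conj_eq_iff_re, starRingEnd_apply, ← trace_conjTranspose, conjTranspose_mul,
    hP.eq, hG.eq, trace_mul_comm]

/-- The trace of a Hermitian matrix is real. -/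
lemma Matrix.IsHermitian.ofReal_re_trace {n : Type*} [Fintype n] {G : Matrix n n ℂ}
    (hG : G.IsHermitian) : ((G.trace.re : ℝ) : ℂ) = G.trace := by
  rw [← Complex.conj_eq_iff_re, starRingEnd_apply, ← trace_conjTranspose, hG.eq]

/-- Bessel's inequality for a Hilbert-Schmidt orthonormal family of Hermitian matrices. -/
lemma sum_sq_re_trace_mul_le {n ι : Type*} [Fintype n] [Fintype ι] [DecidableEq ι]
    {G : ι → Matrix n n ℂ} (hG : ∀ k, (G k).IsHermitian)
    (hON : ∀ k l, (G k * G l).trace = if k = l then 1 else 0)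
    {P : Matrix n n ℂ} (hP : P.IsHermitian) :
    ∑ k, (P * G k).trace.re ^ 2 ≤ (P * P).trace.re := by
  set c : ι → ℝ := fun k => (P * G k).trace.re with hc
  have hPG : ∀ k, (P * G k).trace = (c k : ℂ) := fun k => (hP.ofReal_re_trace_mul (hG k)).symm
  have hGP : ∀ k, (G k * P).trace = (c k : ℂ) := fun k => by rw [trace_mul_comm, hPG]
  set S : Matrix n n ℂ := ∑ k, (c k : ℂ) • G k with hS
  have hSH : Sᴴ = S := by
    simp [hS, conjTranspose_sum, conjTranspose_smul, (hG _).eq]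
  have hPS : (P * S).trace = ∑ k, (c k : ℂ) ^ 2 := by
    simp [hS, Finset.mul_sum, trace_sum, hPG, sq]
  have hSS : (S * S).trace = ∑ k, (c k : ℂ) ^ 2 := by
    simp [hS, Finset.mul_sum, Finset.sum_mul, trace_sum, hON, sq]
  have h0 : 0 ≤ ((P - S)ᴴ * (P - S)).trace := (posSemidef_conjTranspose_mul_self _).trace_nonneg
  have h1 : ((P - S)ᴴ * (P - S)).trace = (P * P).trace - ((∑ k, c k ^ 2 : ℝ) : ℂ) := by
    rw [conjTranspose_sub, hSH, hP.eq, sub_mul, mul_sub, mul_sub, trace_sub, trace_sub, trace_sub,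
      trace_mul_comm S P, hPS, hSS]
    push_cast
    ring
  rw [h1] at h0
  have h2 := (Complex.le_def.1 h0).1
  rw [Complex.sub_re, Complex.ofReal_re, Complex.zero_re] at h2
  linarith

lemma isHermitian_vecMulVec_star {n : Type*} (a : n → ℂ) :
    (vecMulVec a (star a)).IsHermitian := by
  rw [IsHermitian, conjTranspose_vecMulVec, star_star]

lemma trace_vecMulVec_star {n : Type*} [Fintype n] {a : n → ℂ} (ha : star a ⬝ᵥ a = 1) :
    (vecMulVec a (star a)).trace = 1 := by
  rw [trace_vecMulVec, dotProduct_comm, ha]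

lemma trace_vecMulVec_star_mul_self {n : Type*} [Fintype n] {a : n → ℂ}
    (ha : star a ⬝ᵥ a = 1) :
    (vecMulVec a (star a) * vecMulVec a (star a)).trace = 1 := by
  rw [vecMulVec_mul_vecMulVec, ha]
  simpa using trace_vecMulVec_star ha

/-- Twice a covariance is at most the sum of the two variances. -/
lemma two_mul_abs_covariance_le {ι : Type*} [Fintype ι] {p : ι → ℝ} (hp : ∀ j, 0 ≤ p j)
    (hp1 : ∑ j, p j = 1) (x y : ι → ℝ) :
    2 * |∑ j, p j * (x j * y j) - (∑ j, p j * x j) * ∑ j, p j * y j|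
      ≤ ∑ j, p j * (x j ^ 2 + y j ^ 2) - ((∑ j, p j * x j) ^ 2 + (∑ j, p j * y j) ^ 2) := by
  set X := ∑ j, p j * x j with hX
  set Y := ∑ j, p j * y j with hY
  have key : ∀ s : ℝ, ∑ j, p j * ((x j - X) + s * (y j - Y)) ^ 2
      = ∑ j, p j * (x j ^ 2 + s ^ 2 * y j ^ 2) - (X ^ 2 + s ^ 2 * Y ^ 2)
        + 2 * s * (∑ j, p j * (x j * y j) - X * Y) := by
    intro s
    have : ∀ j, p j * ((x j - X) + s * (y j - Y)) ^ 2
        = p j * (x j ^ 2 + s ^ 2 * y j ^ 2) + 2 * s * (p j * (x j * y j))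
          - (2 * X + 2 * s * Y) * (p j * x j) - (2 * s * X + 2 * s ^ 2 * Y) * (p j * y j)
          + (X + s * Y) ^ 2 * p j := fun j => by ring
    simp only [this, Finset.sum_add_distrib, Finset.sum_sub_distrib, ← Finset.mul_sum, hp1,
      ← hX, ← hY]
    ring
  have nonneg : ∀ s : ℝ, 0 ≤ ∑ j, p j * ((x j - X) + s * (y j - Y)) ^ 2 := fun s =>
    Finset.sum_nonneg fun j _ => mul_nonneg (hp j) (sq_nonneg _)
  have h1 := key 1 ▸ nonneg 1
  have h2 := key (-1) ▸ nonneg (-1)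
  norm_num at h1 h2
  rcases abs_cases (∑ j, p j * (x j * y j) - X * Y) with h | h <;> linarith

/-- The covariance bound summed over a family of pairs of variables whose squares sum
pointwise to at most one. -/
lemma two_mul_sum_abs_covariance_le {ι κ : Type*} [Fintype ι] [Fintype κ] {p : ι → ℝ}
    (hp : ∀ j, 0 ≤ p j) (hp1 : ∑ j, p j = 1) {x y : ι → κ → ℝ}
    (hx : ∀ j, ∑ k, x j k ^ 2 ≤ 1) (hy : ∀ j, ∑ k, y j k ^ 2 ≤ 1) :
    2 * ∑ k, |∑ j, p j * (x j k * y j k) - (∑ j, p j * x j k) * ∑ j, p j * y j k|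
      ≤ 2 - ∑ k, ((∑ j, p j * x j k) ^ 2 + (∑ j, p j * y j k) ^ 2) := by
  have h : ∑ k, ∑ j, p j * (x j k ^ 2 + y j k ^ 2) ≤ 2 := by
    rw [Finset.sum_comm]
    calc ∑ j, ∑ k, p j * (x j k ^ 2 + y j k ^ 2) ≤ ∑ j, p j * 2 := by
          refine Finset.sum_le_sum fun j _ => ?_
          rw [← Finset.mul_sum, Finset.sum_add_distrib]
          exact mul_le_mul_of_nonneg_left (by linarith [hx j, hy j]) (hp j)
      _ = 2 := by rw [← Finset.sum_mul, hp1, one_mul]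
  have h' := Finset.sum_le_sum fun k (_ : k ∈ Finset.univ) =>
    two_mul_abs_covariance_le hp hp1 (fun j => x j k) (fun j => y j k)
  rw [← Finset.mul_sum, Finset.sum_sub_distrib] at h'
  linarith

/-- The expectation of a local observable `X ⊗ Y` in a sum of product operators. -/
lemma trace_sum_smul_kronecker_mul {m n ι : Type*} [Fintype m] [Fintype n] [Fintype ι]
    (c : ι → ℂ) (A : ι → Matrix m m ℂ) (B : ι → Matrix n n ℂ)
    (X : Matrix m m ℂ) (Y : Matrix n n ℂ) :
    ((∑ i, c i • (A i ⊗ₖ B i)) * (X ⊗ₖ Y)).trace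
      = ∑ i, c i * ((A i * X).trace * (B i * Y).trace) := by
  simp [Finset.sum_mul, trace_sum, ← mul_kronecker_mul, trace_kronecker]

/-- The Schmidt CMC: if ρ = Σ_k λ_k G_k^A ⊗ G_k^B (Schmidt decomposition in
operator space) is separable, then with g_k^A = tr G_k^A, g_k^B = tr G_k^B,
2 Σ_k |λ_k − λ_k² g_k^A g_k^B| ≤ 2 − Σ_k λ_k² [(g_k^A)² + (g_k^B)²]. -/
theorem schmidt_cmc {dA dB : ℕ} (hd : dA ≤ dB)
    (GA : Fin (dA ^ 2) → Matrix (Fin dA) (Fin dA) ℂ)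
    (hGAH : ∀ k, (GA k).IsHermitian)
    (hGAON : ∀ k l, (GA k * GA l).trace = if k = l then 1 else 0)
    (GB : Fin (dA ^ 2) → Matrix (Fin dB) (Fin dB) ℂ)
    (hGBH : ∀ k, (GB k).IsHermitian)
    (hGBON : ∀ k l, (GB k * GB l).trace = if k = l then 1 else 0)
    (l : Fin (dA ^ 2) → ℝ) (hl : ∀ k, 0 ≤ l k)
    (hsep : Separable (∑ k, (l k : ℂ) • (GA k ⊗ₖ GB k))) :
    2 * ∑ k, |l k - (l k) ^ 2 * ((GA k).trace).re * ((GB k).trace).re|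
      ≤ 2 - ∑ k, (l k) ^ 2 * (((GA k).trace).re ^ 2 + ((GB k).trace).re ^ 2) := by
  obtain ⟨m, p, a, b, hp, hp1, ha, hb, hρ⟩ := hsep
  set P := fun j => vecMulVec (a j) (star (a j))
  set Q := fun j => vecMulVec (b j) (star (b j))
  have hP : ∀ j, (P j).IsHermitian := fun j => isHermitian_vecMulVec_star _
  have hQ : ∀ j, (Q j).IsHermitian := fun j => isHermitian_vecMulVec_star _
  set x := fun j k => (P j * GA k).trace.re
  set y := fun j k => (Q j * GB k).trace.re
  have hx : ∀ j k, (P j * GA k).trace = (x j k : ℂ) := fun j k =>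
    ((hP j).ofReal_re_trace_mul (hGAH k)).symm
  have hy : ∀ j k, (Q j * GB k).trace = (y j k : ℂ) := fun j k =>
    ((hQ j).ofReal_re_trace_mul (hGBH k)).symm
  have hPt : ∀ j, (P j).trace = 1 := fun j => trace_vecMulVec_star (ha j)
  have hQt : ∀ j, (Q j).trace = 1 := fun j => trace_vecMulVec_star (hb j)
  have expect : ∀ X Y, ∑ i, (l i : ℂ) * ((GA i * X).trace * (GB i * Y).trace)
      = ∑ j, (p j : ℂ) * ((P j * X).trace * (Q j * Y).trace) := fun X Y => by
    rw [← trace_sum_smul_kronecker_mul, ← trace_sum_smul_kronecker_mul, hρ]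
  have hxy : ∀ k, ∑ j, p j * (x j k * y j k) = l k := fun k => by
    have := expect (GA k) (GB k)
    simp only [hGAON, hGBON, hx, hy] at this
    simp at this
    exact_mod_cast this.symm
  have hxm : ∀ k, ∑ j, p j * x j k = l k * (GB k).trace.re := fun k => by
    have := expect (GA k) 1
    simp only [hGAON, hx, mul_one, hQt] at this
    simp at this
    rw [← (hGBH k).ofReal_re_trace] at this
    exact_mod_cast this.symm
  have hym : ∀ k, ∑ j, p j * y j k = l k * (GA k).trace.re := fun k => by
    have := expect 1 (GB k)
    simp only [hGBON, hy, mul_one, one_mul, hPt] at this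
    simp at this
    rw [← (hGAH k).ofReal_re_trace] at this
    exact_mod_cast this.symm
  have hx1 : ∀ j, ∑ k, x j k ^ 2 ≤ 1 := fun j =>
    (sum_sq_re_trace_mul_le hGAH hGAON (hP j)).trans_eq
      (by rw [trace_vecMulVec_star_mul_self (ha j), Complex.one_re])
  have hy1 : ∀ j, ∑ k, y j k ^ 2 ≤ 1 := fun j =>
    (sum_sq_re_trace_mul_le hGBH hGBON (hQ j)).trans_eq
      (by rw [trace_vecMulVec_star_mul_self (hb j), Complex.one_re])
  have main := two_mul_sum_abs_covariance_le hp hp1 hx1 hy1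
  simp only [hxy, hxm, hym] at main
  convert main using 5 <;> ring
end
end
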